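/- Under the same hypotheses (1)–(5) as in the uniform boundedness result for discrete material measures (μ = μ_D × H^N⌞E with uniformly bounded and uniformly tight thermalizations μ_β for β ≥ β₀; discrete approximations μ_h = (Σ_{p∈P_h} m_p δ_p) × H^N⌞E with partitions {A_p}, weights m_p ≤ c̄ μ_D(A_p), β_h → ∞, ε_h → 0, (β_h ε_h²) bounded, ‖p − z‖² ≤ c_*²(ε_h² + ‖y − z‖²) for z ∈ E, y ∈ A_p, and ∫_{A_p} ‖y − p‖² dμ_D ≤ ε_h² μ_D(A_p)), there is h₀ such that the sequence ((μ_h)_{β_h})_{h ≥ h₀} is uniformly tight: for every ε > 0 there is a compact set K ⊆ Z × Z with (μ_h)_{β_h}((Z × Z) \ K) < ε for all h ≥ h₀. -/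

import Mathlib

open MeasureTheory Real Filter Topology

noncomputable section

/-- Phase space `Z`, identified with `ℝ^{2N}` (with Lebesgue measure `volume`). -/
abbrev ZZ (N : ℕ) := EuclideanSpace ℝ (Fin (2 * N))

/-- The normalization constant `B_β = ∫_Z exp(−β‖ξ‖²) dL^{2N}(ξ)`. -/
def Bconst (N : ℕ) (β : ℝ) : ℝ := ∫ ξ : ZZ N, Real.exp (-β * ‖ξ‖ ^ 2)

/-- The thermalization `μ_β := w_β · μ` with `w_β(y,z) = B_β⁻¹ exp(−β‖y−z‖²)`. -/
def therm {N : ℕ} (μ : Measure (ZZ N × ZZ N)) (β : ℝ) : Measure (ZZ N × ZZ N) :=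
  μ.withDensity fun q => ENNReal.ofReal ((Bconst N β)⁻¹ * Real.exp (-β * ‖q.1 - q.2‖ ^ 2))

/-- The deterministic physical likelihood `μ_E = H^N ⌞ E`. -/
def muE (N : ℕ) (E : AffineSubspace ℝ (ZZ N)) : Measure (ZZ N) :=
  (μH[(N : ℝ)]).restrict (E : Set (ZZ N))

/-- The sub-Gaussian material likelihood `μ_D = e^{−Φ} L^{2N}`. -/
def muD (N : ℕ) (Φ : ZZ N → ℝ) : Measure (ZZ N) :=
  volume.withDensity fun y => ENNReal.ofReal (Real.exp (-Φ y))

/-!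
STATEMENT 13: uniform tightness of thermalized discrete approximations
(Prop. "Boundedness and tightness", part b). Under hypotheses (1)–(5),
there is `h₀` such that for every `ε' > 0` there is a compact `K ⊆ Z × Z`
with `(μ_h)_{β_h}((Z × Z) \ K) < ε'` for all `h ≥ h₀`.
-/

open scoped ENNReal

lemma sFinite_muE (N : ℕ) (E : AffineSubspace ℝ (ZZ N)) (hE : (E : Set (ZZ N)).Nonempty)
    (hdim : Module.finrank ℝ E.direction = N) : SFinite (muE N E) := by
  obtain ⟨x, hx⟩ := hE
  have hf : Isometry fun v : E.direction => (v : ZZ N) + x :=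
    (IsometryEquiv.addRight x).isometry.comp isometry_subtype_coe
  have hrange : Set.range (fun v : E.direction => (v : ZZ N) + x) = E := by
    ext y
    constructor
    · rintro ⟨v, rfl⟩
      exact AffineSubspace.vadd_mem_of_mem_direction v.2 hx
    · intro hy
      exact ⟨⟨y - x, AffineSubspace.vsub_mem_direction hy hx⟩, sub_add_cancel y x⟩
  have hmap := hf.map_hausdorffMeasure (d := (N : ℝ)) (Or.inl N.cast_nonneg)
  rw [hrange] at hmap
  have hhaar : Measure.IsAddHaarMeasure (μH[(N : ℝ)] : Measure E.direction) := by
    have := MeasureTheory.isAddHaarMeasure_hausdorffMeasure (E := E.direction)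
    rwa [hdim] at this
  rw [muE, ← hmap]
  infer_instance

lemma sigmaFinite_of_countable_partition {α ι : Type*} [MeasurableSpace α] [Countable ι]
    {μ : Measure α} {A : ι → Set α} (hcover : (⋃ i, A i) = Set.univ)
    (hfin : ∀ i, μ (A i) < ∞) : SigmaFinite μ :=
  Measure.sigmaFinite_of_countable (S := Set.range A) (Set.countable_range A)
    (by rintro _ ⟨i, rfl⟩; exact hfin i) (by rw [Set.sUnion_range, hcover])

lemma Bconst_pos {N : ℕ} {β : ℝ} (hβ : 0 < β) : 0 < Bconst N β := by
  rw [Bconst, GaussianFourier.integral_rexp_neg_mul_sq_norm hβ]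
  positivity

lemma Bconst_half {N : ℕ} {β : ℝ} (hβ : 0 < β) : Bconst N (β / 2) = 2 ^ N * Bconst N β := by
  rw [Bconst, Bconst, GaussianFourier.integral_rexp_neg_mul_sq_norm hβ,
    GaussianFourier.integral_rexp_neg_mul_sq_norm (half_pos hβ), finrank_euclideanSpace_fin]
  have hN : ((2 * N : ℕ) : ℝ) / 2 = N := by push_cast; ring
  rw [hN, rpow_natCast, rpow_natCast, ← mul_pow]
  congr 1
  field_simp

lemma therm_prod_apply {N : ℕ} (ν κ : Measure (ZZ N)) [SFinite ν] [SFinite κ] (β : ℝ)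
    {S : Set (ZZ N × ZZ N)} (hS : MeasurableSet S) :
    therm (ν.prod κ) β S = ∫⁻ z, ∫⁻ y, S.indicator (fun q : ZZ N × ZZ N =>
      ENNReal.ofReal ((Bconst N β)⁻¹ * exp (-β * ‖q.1 - q.2‖ ^ 2))) (y, z) ∂ν ∂κ := by
  rw [therm, withDensity_apply _ hS, ← lintegral_indicator hS, lintegral_prod_symm']
  exact Measurable.indicator (by fun_prop) hS

/-- Jensen's inequality for `exp`, applied to the second moment of `μ` on `A` about `p`. -/
lemma measure_mul_exp_le_setLIntegral {V : Type*} [NormedAddCommGroup V] [MeasurableSpace V]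
    [BorelSpace V] (μ : Measure V) {A : Set V} (hfin : μ A < ∞) (p : V) {β ε : ℝ} (hβ : 0 ≤ β)
    (hmom : ∫⁻ y in A, ENNReal.ofReal (‖y - p‖ ^ 2) ∂μ ≤ ENNReal.ofReal (ε ^ 2) * μ A) :
    ENNReal.ofReal (exp (-β * ε ^ 2)) * μ A
      ≤ ∫⁻ y in A, ENNReal.ofReal (exp (-β * ‖y - p‖ ^ 2)) ∂μ := by
  set e := exp (-β * ε ^ 2) with he
  have he0 : 0 < e := exp_pos _
  have htangent : ∀ y, ENNReal.ofReal e + ENNReal.ofReal (e * β * ε ^ 2)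
      ≤ ENNReal.ofReal (exp (-β * ‖y - p‖ ^ 2))
        + ENNReal.ofReal (e * β) * ENNReal.ofReal (‖y - p‖ ^ 2) := by
    intro y
    rw [← ENNReal.ofReal_mul (by positivity), ← ENNReal.ofReal_add (by positivity) (by positivity),
      ← ENNReal.ofReal_add (by positivity) (by positivity)]
    refine ENNReal.ofReal_le_ofReal ?_
    have hexp : exp (-β * ‖y - p‖ ^ 2) = e * exp (-β * ‖y - p‖ ^ 2 - -β * ε ^ 2) := by
      rw [he, ← exp_add]
      ring_nf
    have hlin := mul_le_mul_of_nonneg_left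
      (add_one_le_exp (-β * ‖y - p‖ ^ 2 - -β * ε ^ 2)) he0.le
    rw [hexp]
    linarith
  have hint := lintegral_mono (μ := μ.restrict A) htangent
  rw [lintegral_const, Measure.restrict_apply_univ, lintegral_add_left (by fun_prop),
    lintegral_const_mul _ (by fun_prop), add_mul] at hint
  have hmom' : ENNReal.ofReal (e * β) * ∫⁻ y in A, ENNReal.ofReal (‖y - p‖ ^ 2) ∂μ
      ≤ ENNReal.ofReal (e * β * ε ^ 2) * μ A := by
    rw [ENNReal.ofReal_mul (p := e * β) (by positivity), mul_assoc]
    gcongr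
  exact (ENNReal.add_le_add_iff_right (ENNReal.mul_ne_top ENNReal.ofReal_ne_top hfin.ne)).1
    (hint.trans (by gcongr))

/-- The Gaussian weight at the sample point `p` of a cell `A` is controlled by the average over
`A` of the Gaussian weight at half the inverse temperature. -/
lemma mul_weight_le_setLIntegral_weight_half {N : ℕ} (μ : Measure (ZZ N)) {A : Set (ZZ N)}
    (hfin : μ A < ∞) (p z : ZZ N) {β ε C c : ℝ} (hβ : 0 < β) (hC : β * ε ^ 2 ≤ C) (hc : 0 ≤ c)
    (hmom : ∫⁻ y in A, ENNReal.ofReal (‖y - p‖ ^ 2) ∂μ ≤ ENNReal.ofReal (ε ^ 2) * μ A)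
    {m : ℝ≥0∞} (hm : m ≤ ENNReal.ofReal c * μ A) :
    m * ENNReal.ofReal ((Bconst N β)⁻¹ * exp (-β * ‖p - z‖ ^ 2))
      ≤ ENNReal.ofReal (c * exp C * 2 ^ N) * ∫⁻ y in A, ENNReal.ofReal
        ((Bconst N (β / 2))⁻¹ * exp (-(β / 2) * ‖y - z‖ ^ 2)) ∂μ := by
  have hB : 0 < Bconst N β := Bconst_pos hβ
  have hjensen := measure_mul_exp_le_setLIntegral μ hfin p hβ.le hmom
  have hpoint : ∀ y, (Bconst N β)⁻¹ * exp (-β * ‖p - z‖ ^ 2) * exp (-β * ‖y - p‖ ^ 2)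
      ≤ 2 ^ N * ((Bconst N (β / 2))⁻¹ * exp (-(β / 2) * ‖y - z‖ ^ 2)) := by
    intro y
    rw [Bconst_half hβ, mul_assoc, ← exp_add, mul_inv, ← mul_assoc, ← mul_assoc,
      mul_inv_cancel₀ (by positivity), one_mul]
    gcongr
    have htri : ‖y - z‖ ≤ ‖y - p‖ + ‖p - z‖ := norm_sub_le_norm_sub_add_norm_sub y p z
    have hsq : ‖y - z‖ ^ 2 ≤ 2 * (‖y - p‖ ^ 2 + ‖p - z‖ ^ 2) := by
      nlinarith [sq_nonneg (‖y - p‖ - ‖p - z‖), norm_nonneg (y - z)]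
    nlinarith
  have hexpC : (1 : ℝ) ≤ exp C * exp (-β * ε ^ 2) := by
    rw [← exp_add]
    exact one_le_exp (by linarith)
  set w := (Bconst N β)⁻¹ * exp (-β * ‖p - z‖ ^ 2)
  have hw : 0 ≤ w := by positivity
  calc m * ENNReal.ofReal w
      ≤ ENNReal.ofReal c * μ A * ENNReal.ofReal w := by gcongr
    _ ≤ ENNReal.ofReal c * (ENNReal.ofReal (exp C * exp (-β * ε ^ 2)) * μ A)
          * ENNReal.ofReal w := by
        gcongr
        exact le_mul_of_one_le_left zero_le (ENNReal.one_le_ofReal.2 hexpC)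
    _ = ENNReal.ofReal (c * exp C) * (ENNReal.ofReal w
          * (ENNReal.ofReal (exp (-β * ε ^ 2)) * μ A)) := by
        rw [ENNReal.ofReal_mul (exp_nonneg _), ENNReal.ofReal_mul hc]
        ring
    _ ≤ ENNReal.ofReal (c * exp C) * (ENNReal.ofReal w
          * ∫⁻ y in A, ENNReal.ofReal (exp (-β * ‖y - p‖ ^ 2)) ∂μ) := by gcongr
    _ ≤ ENNReal.ofReal (c * exp C) * (ENNReal.ofReal (2 ^ N) * ∫⁻ y in A, ENNReal.ofReal
          ((Bconst N (β / 2))⁻¹ * exp (-(β / 2) * ‖y - z‖ ^ 2)) ∂μ) := by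
        refine mul_le_mul_right ?_ _
        rw [← lintegral_const_mul _ (by fun_prop), ← lintegral_const_mul _ (by fun_prop)]
        refine lintegral_mono fun y => ?_
        rw [← ENNReal.ofReal_mul hw, ← ENNReal.ofReal_mul (by positivity)]
        exact ENNReal.ofReal_le_ofReal (hpoint y)
    _ = _ := by
        rw [ENNReal.ofReal_mul (p := c * exp C) (by positivity), mul_assoc]

/-- Comparison of the thermalized discrete measure outside `K` with the thermalized continuous
measure outside `L`, provided that cells whose sample point leaves the slice of `K` lie outside
the slice of `L`. -/
lemma therm_discrete_compl_le {N : ℕ} (μ κ : Measure (ZZ N)) [SFinite μ] [SFinite κ]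
    {ι : Type*} [Countable ι] {p : ι → ZZ N} {A : ι → Set (ZZ N)} {m : ι → ℝ≥0∞}
    (hAmeas : ∀ i, MeasurableSet (A i)) (hdisj : Pairwise fun i j => Disjoint (A i) (A j))
    (hcover : (⋃ i, A i) = Set.univ) (hfin : ∀ i, μ (A i) < ∞)
    {β ε C c : ℝ} (hβ : 0 < β) (hC : β * ε ^ 2 ≤ C) (hc : 0 ≤ c)
    (hm : ∀ i, m i ≤ ENNReal.ofReal c * μ (A i))
    (hmom : ∀ i, ∫⁻ y in A i, ENNReal.ofReal (‖y - p i‖ ^ 2) ∂μ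
      ≤ ENNReal.ofReal (ε ^ 2) * μ (A i))
    {K L : Set (ZZ N × ZZ N)} (hK : MeasurableSet K) (hL : MeasurableSet L)
    (hKL : ∀ᵐ z ∂κ, ∀ i, (p i, z) ∉ K → ∀ y ∈ A i, (y, z) ∉ L) :
    therm ((Measure.sum fun i => m i • Measure.dirac (p i)).prod κ) β Kᶜ
      ≤ ENNReal.ofReal (c * exp C * 2 ^ N) * therm (μ.prod κ) (β / 2) Lᶜ := by
  rw [therm_prod_apply _ _ _ hK.compl, therm_prod_apply _ _ _ hL.compl,
    ← lintegral_const_mul' _ _ ENNReal.ofReal_ne_top]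
  refine lintegral_mono_ae ?_
  filter_upwards [hKL] with z hz
  rw [lintegral_sum_measure, ← setLIntegral_univ (μ := μ), ← hcover, lintegral_iUnion hAmeas hdisj,
    ← ENNReal.tsum_mul_left]
  refine ENNReal.tsum_le_tsum fun i => ?_
  rw [lintegral_smul_measure, lintegral_dirac, smul_eq_mul]
  by_cases hi : (p i, z) ∈ K
  · simp [hi]
  · rw [Set.indicator_of_mem (show (p i, z) ∈ Kᶜ from hi),
      setLIntegral_congr_fun (hAmeas i) fun y hy =>
        Set.indicator_of_mem (show (y, z) ∈ Lᶜ from hz i hi y hy) _]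
    exact mul_weight_le_setLIntegral_weight_half μ (hfin i) (p i) z hβ hC hc (hmom i) (hm i)

theorem discrete_approximation_uniformly_tight
    (N : ℕ) (μD : Measure (ZZ N))
    (E : AffineSubspace ℝ (ZZ N)) (hE : (E : Set (ZZ N)).Nonempty)
    (hdim : Module.finrank ℝ E.direction = N)
    (β₀ : ℝ) (hβ₀ : 0 < β₀)
    -- (1) uniform boundedness and tightness of the thermalizations of μ = μ_D × μ_E
    (hbd : ∃ C : ENNReal, C < ⊤ ∧ ∀ β : ℝ, β₀ ≤ β →
      (therm (μD.prod (muE N E)) β) Set.univ ≤ C)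
    (htight : ∀ δ : ℝ, 0 < δ → ∃ K : Set (ZZ N × ZZ N), IsCompact K ∧
      ∀ β : ℝ, β₀ ≤ β → (therm (μD.prod (muE N E)) β) Kᶜ < ENNReal.ofReal δ)
    -- annealing and resolution sequences
    (β : ℕ → ℝ) (hβ : Tendsto β atTop atTop)
    (ε : ℕ → ℝ) (hεpos : ∀ h, 0 < ε h) (hε : Tendsto ε atTop (𝓝 0))
    -- for every h, a countable Borel partition {A_p : p ∈ P_h} of Z with p ∈ A_p
    (ι : ℕ → Type) [∀ h, Countable (ι h)]
    (p : ∀ h, ι h → ZZ N) (A : ∀ h, ι h → Set (ZZ N))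
    (hAmeas : ∀ h i, MeasurableSet (A h i))
    (hdisj : ∀ h, Pairwise fun i j => Disjoint (A h i) (A h j))
    (hcover : ∀ h, (⋃ i, A h i) = Set.univ)
    (hpA : ∀ h i, p h i ∈ A h i)
    (hAfin : ∀ h i, μD (A h i) < ⊤)
    -- weights
    (m : ∀ h, ι h → ENNReal)
    -- (2) m_p ≤ c̄ μ_D(A_p)
    (cbar : ℝ) (hcbar : 0 < cbar)
    (hm : ∀ h i, m h i ≤ ENNReal.ofReal cbar * μD (A h i))
    -- (3) (β_h ε_h²) is bounded
    (hβε : ∃ Cb : ℝ, ∀ h, |β h * (ε h) ^ 2| ≤ Cb)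
    -- (4) ‖p − z‖² ≤ c_*²(ε_h² + ‖y − z‖²)
    (cstar : ℝ) (hcstar : 1 ≤ cstar)
    (hcell : ∀ h, ∀ i, ∀ z ∈ E, ∀ y ∈ A h i,
      ‖p h i - z‖ ^ 2 ≤ cstar ^ 2 * ((ε h) ^ 2 + ‖y - z‖ ^ 2))
    -- (5) second moments
    (hmom : ∀ h i, ∫⁻ y in A h i, ENNReal.ofReal (‖y - p h i‖ ^ 2) ∂μD
      ≤ ENNReal.ofReal ((ε h) ^ 2) * μD (A h i)) :
    ∃ h₀ : ℕ, ∀ ε' : ℝ, 0 < ε' → ∃ K : Set (ZZ N × ZZ N), IsCompact K ∧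
      ∀ h, h₀ ≤ h →
      (therm ((Measure.sum fun i => m h i • Measure.dirac (p h i)).prod (muE N E)) (β h))
        Kᶜ < ENNReal.ofReal ε' := by
  obtain ⟨Cb, hCb⟩ := hβε
  have : SFinite (muE N E) := sFinite_muE N E hE hdim
  have : SigmaFinite μD := sigmaFinite_of_countable_partition (hcover 0) (hAfin 0)
  obtain ⟨h₀, hh₀⟩ := eventually_atTop.1
    ((hβ.eventually_ge_atTop (2 * β₀)).and (hε.eventually_le_const one_pos))
  refine ⟨h₀, fun ε' hε' => ?_⟩
  set M : ℝ := cbar * exp Cb * 2 ^ N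
  have hM0 : 0 < M := by positivity
  obtain ⟨L, hLcpt, hL⟩ := htight (ε' / M) (by positivity)
  obtain ⟨R, hR0, hLR⟩ := hLcpt.isBounded.subset_closedBall_lt 0 0
  refine ⟨Metric.closedBall 0 (R + cstar * (1 + 2 * R)) ×ˢ Metric.closedBall 0 R,
    (isCompact_closedBall _ _).prod (isCompact_closedBall _ _), fun h hh => ?_⟩
  obtain ⟨hβh, hεh⟩ := hh₀ h hh
  have hcell_far : ∀ᵐ z ∂muE N E, ∀ i,
      (p h i, z) ∉ Metric.closedBall (0 : ZZ N) (R + cstar * (1 + 2 * R)) ×ˢ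
        Metric.closedBall (0 : ZZ N) R → ∀ y ∈ A h i, (y, z) ∉ L := by
    have hEmeas : MeasurableSet (E : Set (ZZ N)) :=
      (AffineSubspace.closed_of_finiteDimensional E).measurableSet
    filter_upwards [ae_restrict_mem hEmeas] with z hz i hi y hy hyz
    have hyzR := hLR hyz
    rw [mem_closedBall_zero_iff, Prod.norm_def, max_le_iff] at hyzR
    obtain ⟨hyR, hzR⟩ := hyzR
    simp only at hyR hzR
    apply hi
    refine ⟨mem_closedBall_zero_iff.2 ?_, mem_closedBall_zero_iff.2 hzR⟩
    have hyz_norm : ‖y - z‖ ≤ 2 * R := (norm_sub_le y z).trans (by linarith)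
    have hpz : ‖p h i - z‖ ≤ cstar * (1 + 2 * R) := by
      refine le_of_sq_le_sq ((hcell h i z hz y hy).trans ?_) (by positivity)
      rw [mul_pow]
      gcongr
      nlinarith [hεpos h, norm_nonneg (y - z)]
    have := norm_le_norm_sub_add (p h i) z
    simp only
    linarith
  calc _ ≤ ENNReal.ofReal M * therm (μD.prod (muE N E)) (β h / 2) Lᶜ :=
        therm_discrete_compl_le μD (muE N E) (hAmeas h) (hdisj h) (hcover h) (hAfin h)
          (by linarith) ((le_abs_self _).trans (hCb h)) hcbar.le (hm h) (hmom h)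
          (measurableSet_closedBall.prod measurableSet_closedBall) hLcpt.measurableSet hcell_far
    _ < ENNReal.ofReal M * ENNReal.ofReal (ε' / M) :=
        ENNReal.mul_lt_mul_right (ENNReal.ofReal_pos.2 hM0).ne' ENNReal.ofReal_ne_top
          (hL _ (by linarith))
    _ = ENNReal.ofReal ε' := by
        rw [← ENNReal.ofReal_mul hM0.le, mul_div_cancel₀ _ hM0.ne']
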